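/- There is no finite group G of order p^n q^m (p, q distinct primes) with nontrivial center, whose Sylow p-subgroups have center of order p and Sylow q-subgroups have center of order q, and which satisfies |CD(G)| = |L(G)| - 2 with the Chermak-Delgado measure taking exactly three distinct values on subgroups of G. -/

import Mathlib

/-- The Chermak-Delgado measure of a subgroup `H` of `G`: `m_G(H) = |H| * |C_G(H)|`. -/
noncomputable def cdMeasure (G : Type*) [Group G] (H : Subgroup G) : ℕ :=
  Nat.card H * Nat.card (Subgroup.centralizer (H : Set G))

/-- The Chermak-Delgado lattice of `G`: the set of subgroups whose Chermak-Delgado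
measure is maximal among all subgroups of `G`. -/
def cdLattice (G : Type*) [Group G] : Set (Subgroup G) :=
  {H | ∀ K : Subgroup G, cdMeasure G K ≤ cdMeasure G H}

/-- Every member of the Chermak-Delgado lattice contains the center. -/
theorem center_le_of_mem_cdLattice {G : Type*} [Group G] [Finite G] {H : Subgroup G}
    (hH : H ∈ cdLattice G) : Subgroup.center G ≤ H := by
  have hC : Subgroup.centralizer (H : Set G) ≤
      Subgroup.centralizer ((H ⊔ Subgroup.center G : Subgroup G) : Set G) := by
    rw [Subgroup.le_centralizer_iff]
    exact sup_le (Subgroup.le_centralizer_iff.mp le_rfl) (Subgroup.center_le_centralizer _)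
  have hle : Nat.card (H ⊔ Subgroup.center G : Subgroup G) ≤ Nat.card H :=
    Nat.le_of_mul_le_mul_right
      ((Nat.mul_le_mul_left _ (Subgroup.card_le_of_le hC)).trans (hH (H ⊔ Subgroup.center G)))
      Nat.card_pos
  rw [Subgroup.eq_of_le_of_card_ge le_sup_left hle]
  exact le_sup_right

/-- If all but two subgroups lie in the Chermak-Delgado lattice, then so does any subgroup
other than two given distinct subgroups outside it. -/
theorem mem_cdLattice_of_card_eq_sub_two {G : Type*} [Group G] [Finite G]
    (h : Nat.card (cdLattice G) = Nat.card (Subgroup G) - 2) {A B K : Subgroup G}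
    (hA : A ∉ cdLattice G) (hB : B ∉ cdLattice G) (hAB : A ≠ B) (hKA : K ≠ A) (hKB : K ≠ B) :
    K ∈ cdLattice G := by
  by_contra hK
  have hsub : ({K, A, B} : Set (Subgroup G)) ⊆ (cdLattice G)ᶜ := by
    rintro X (rfl | rfl | rfl) <;> assumption
  have h3 : ({K, A, B} : Set (Subgroup G)).ncard = 3 :=
    Set.ncard_eq_three.mpr ⟨K, A, B, hKA, hKB, hAB, rfl⟩
  have hle := Set.ncard_le_ncard hsub
  have hadd := Set.ncard_add_ncard_compl (cdLattice G)
  rw [Nat.card_coe_set_eq] at h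
  omega

/-- If `p` divides the order of the center of a group of order `p ^ n * q ^ m` divisible by `q`,
then the number of subgroups outside the Chermak-Delgado lattice is not two. -/
theorem card_cdLattice_ne_sub_two_of_dvd_card_center {G : Type*} [Group G] [Finite G]
    {p q n m : ℕ} (hp : p.Prime) (hq : q.Prime) (hpq : p ≠ q) (hG : Nat.card G = p ^ n * q ^ m)
    (hpZ : p ∣ Nat.card (Subgroup.center G)) (hqG : q ∣ Nat.card G) :
    Nat.card (cdLattice G) ≠ Nat.card (Subgroup G) - 2 := by
  intro h
  have := Fact.mk hp
  have := Fact.mk hq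
  have hpG : p ∣ Nat.card G := hpZ.trans (Subgroup.card_subgroup_dvd_card _)
  let P : Sylow p G := default
  let Q : Sylow q G := default
  have hq_group {H : Subgroup G} (hH : IsPGroup q H) : ¬ p ∣ Nat.card H := fun hd => by
    obtain ⟨k, hk⟩ := IsPGroup.iff_card.mp hH
    exact hpq ((Nat.prime_dvd_prime_iff_eq hp hq).mp (hp.dvd_of_dvd_pow (hk ▸ hd)))
  have hqP : ¬ q ∣ Nat.card (P : Subgroup G) := fun hd => by
    obtain ⟨k, hk⟩ := IsPGroup.iff_card.mp P.isPGroup'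
    exact hpq ((Nat.prime_dvd_prime_iff_eq hq hp).mp (hq.dvd_of_dvd_pow (hk ▸ hd))).symm
  have hnot {H : Subgroup G} (hH : IsPGroup q H) : H ∉ cdLattice G := fun hmem =>
    hq_group hH (hpZ.trans (Subgroup.card_dvd_of_le (center_le_of_mem_cdLattice hmem)))
  have hQbot : (⊥ : Subgroup G) ≠ Q := (Q.ne_bot_of_dvd_card hqG).symm
  have hmem {K : Subgroup G} (hK : K ≠ ⊥) (hKQ : K ≠ Q) : K ∈ cdLattice G :=
    mem_cdLattice_of_card_eq_sub_two h (hnot IsPGroup.of_bot) (hnot Q.isPGroup') hQbot hK hKQ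
  have hmem_of_dvd {K : Subgroup G} (hK : p ∣ Nat.card K) : K ∈ cdLattice G :=
    hmem (fun e => hq_group IsPGroup.of_bot (e ▸ hK)) (fun e => hq_group Q.isPGroup' (e ▸ hK))
  have hPmem : (P : Subgroup G) ∈ cdLattice G := hmem_of_dvd (P.dvd_card_of_dvd_card hpG)
  have htop : (⊤ : Subgroup G) ∈ cdLattice G := hmem_of_dvd (by rwa [Subgroup.card_top])
  have hqm : q ∣ cdMeasure G (P : Subgroup G) := by
    rw [le_antisymm (htop P) (hPmem ⊤), cdMeasure, Subgroup.card_top]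
    exact hqG.mul_right _
  obtain ⟨x, hx⟩ := exists_prime_orderOf_dvd_card' q ((hq.dvd_mul.mp hqm).resolve_left hqP)
  rw [← Subgroup.orderOf_coe] at hx
  have hxQ : Subgroup.zpowers (x : G) = Q := by
    by_contra hne
    refine hnot (IsPGroup.of_card (n := 1) (by rw [Nat.card_zpowers, hx, pow_one])) (hmem ?_ hne)
    rw [Ne, Subgroup.zpowers_eq_bot, ← orderOf_eq_one_iff, hx]
    exact hq.ne_one
  have hPC : (P : Subgroup G) ≤ Subgroup.centralizer {(x : G)} := fun y hy =>
    Subgroup.mem_centralizer_singleton_iff.mpr (x.2 y hy)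
  have hQC : (Q : Subgroup G) ≤ Subgroup.centralizer {(x : G)} := by
    rw [← hxQ, Subgroup.zpowers_le, Subgroup.mem_centralizer_singleton_iff]
  have hC : Subgroup.centralizer {(x : G)} = ⊤ := by
    refine Subgroup.eq_top_of_le_card _ (Nat.le_of_dvd Nat.card_pos ?_)
    rw [hG]
    exact (((Nat.coprime_primes hp hq).mpr hpq).pow n m).mul_dvd_of_dvd_of_dvd
      ((P.pow_dvd_card_of_pow_dvd_card (hG ▸ dvd_mul_right _ _)).trans
        (Subgroup.card_dvd_of_le hPC))
      ((Q.pow_dvd_card_of_pow_dvd_card (hG ▸ dvd_mul_left _ _)).trans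
        (Subgroup.card_dvd_of_le hQC))
  have hxP : (x : G) ∈ (P : Subgroup G) := center_le_of_mem_cdLattice hPmem
    (Subgroup.centralizer_eq_top_iff_subset.mp hC rfl)
  exact hqP (hx ▸ Subgroup.orderOf_dvd_natCard _ hxP)

/-- There is no finite group `G` of order `p^n q^m` (`p ≠ q` primes) with nontrivial
center, whose Sylow `p`-subgroups have center of order `p` and Sylow `q`-subgroups
have center of order `q`, satisfying `|CD(G)| = |L(G)| - 2` with the Chermak-Delgado
measure taking exactly three distinct values on subgroups of `G`. -/
theorem no_cd_eq_sub_two_nontrivial_center (G : Type*) [Group G] [Finite G]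
    (p q n m : ℕ) (hp : p.Prime) (hq : q.Prime) (hpq : p ≠ q)
    (hG : Nat.card G = p ^ n * q ^ m)
    (hZ : Subgroup.center G ≠ ⊥)
    (hP : ∀ P : Sylow p G, Nat.card (Subgroup.center (P : Subgroup G)) = p)
    (hQ : ∀ Q : Sylow q G, Nat.card (Subgroup.center (Q : Subgroup G)) = q)
    (h : Nat.card (cdLattice G) = Nat.card (Subgroup G) - 2)
    (h3 : Nat.card (Set.range (cdMeasure G)) = 3) :
    False := by
  have hpG : p ∣ Nat.card G :=
    (hP default ▸ Subgroup.card_subgroup_dvd_card _).trans (Subgroup.card_subgroup_dvd_card _)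
  have hqG : q ∣ Nat.card G :=
    (hQ default ▸ Subgroup.card_subgroup_dvd_card _).trans (Subgroup.card_subgroup_dvd_card _)
  obtain ⟨r, hr, hrZ⟩ :=
    Nat.exists_prime_and_dvd (mt Subgroup.card_eq_one.mp hZ)
  have hrG : r ∣ p ^ n * q ^ m := hG ▸ hrZ.trans (Subgroup.card_subgroup_dvd_card _)
  rcases hr.dvd_mul.mp hrG with hd | hd
  · rw [(Nat.prime_dvd_prime_iff_eq hr hp).mp (hr.dvd_of_dvd_pow hd)] at hrZ
    exact card_cdLattice_ne_sub_two_of_dvd_card_center hp hq hpq hG hrZ hqG h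
  · rw [(Nat.prime_dvd_prime_iff_eq hr hq).mp (hr.dvd_of_dvd_pow hd)] at hrZ
    exact card_cdLattice_ne_sub_two_of_dvd_card_center hq hp hpq.symm
      (hG.trans (mul_comm _ _)) hrZ hpG h
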